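/- The maps Φ^l_{α,β} and Φ^r_{α,β} are well defined (i.e. Φ^l_{α,β}(A_{αβ}²) ⊆ A_α ⊗ A_β² and Φ^r_{α,β}(A_{αβ}²) ⊆ A_α² ⊗ A_β), and the family A² = {A_α²}_{α∈π} together with Φ^l and Φ^r is a π-graded bicovariant bimodule over A: for all a ∈ A_{αβ} and q ∈ A_{αβ}², Φ^l_{α,β}(a·q) = Δ_{α,β}(a)·Φ^l_{α,β}(q), Φ^l_{α,β}(q·a) = Φ^l_{α,β}(q)·Δ_{α,β}(a), and likewise for Φ^r; (Δ_{α,β} ⊗ id) ∘ Φ^l_{αβ,γ} = (id ⊗ Φ^l_{β,γ}) ∘ Φ^l_{α,βγ}; (ε ⊗ id) ∘ Φ^l_{1,α} = id on A_α²; (Φ^r_{α,β} ⊗ id) ∘ Φ^r_{αβ,γ} = (id ⊗ Δ_{β,γ}) ∘ Φ^r_{α,βγ}; (id ⊗ ε) ∘ Φ^r_{α,1} = id on A_α²; and (Φ^l_{α,β} ⊗ id) ∘ Φ^r_{αβ,γ} = (id ⊗ Φ^r_{β,γ}) ∘ Φ^l_{α,βγ}. -/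

import Mathlib

open TensorProduct

/-- The componentwise action of `R ⊗[k] S` on `M ⊗[k] N` induced by `k`-bilinear
actions `f` of `R` on `M` and `g` of `S` on `N`: `(r ⊗ s) • (m ⊗ n) = (f r m) ⊗ (g s n)`. -/
noncomputable def tact {k : Type} [Field k] {R S M N : Type}
    [AddCommGroup R] [Module k R] [AddCommGroup S] [Module k S]
    [AddCommGroup M] [Module k M] [AddCommGroup N] [Module k N]
    (f : R →ₗ[k] M →ₗ[k] M) (g : S →ₗ[k] N →ₗ[k] N) :
    R ⊗[k] S →ₗ[k] (M ⊗[k] N) →ₗ[k] M ⊗[k] N :=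
  TensorProduct.lift (LinearMap.mk₂ k (fun r s => TensorProduct.map (f r) (g s))
    (fun r r' s => by simp only [map_add, TensorProduct.map_add_left])
    (fun c r s => by simp only [map_smul, TensorProduct.map_smul_left])
    (fun r s s' => by simp only [map_add, TensorProduct.map_add_right])
    (fun r c s => by simp only [map_smul, TensorProduct.map_smul_right]))

/-- `A_α² = ker(m_α : A_α ⊗ A_α → A_α)`. -/
noncomputable def A2sub (k R : Type) [Field k] [Ring R] [Algebra k R] :
    Submodule k (R ⊗[k] R) := LinearMap.ker (LinearMap.mul' k R)

/-- The left `R`-action on `R ⊗ R`: `c • (a ⊗ b) = (c*a) ⊗ b`, as a bilinear map. -/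
noncomputable def lmulTb (k R : Type) [Field k] [Ring R] [Algebra k R] :
    R →ₗ[k] (R ⊗[k] R) →ₗ[k] R ⊗[k] R :=
  (LinearMap.rTensorHom R) ∘ₗ (LinearMap.mul k R)

/-- The right `R`-action on `R ⊗ R`: `(a ⊗ b) • c = a ⊗ (b*c)`, as a bilinear map. -/
noncomputable def rmulTb (k R : Type) [Field k] [Ring R] [Algebra k R] :
    R →ₗ[k] (R ⊗[k] R) →ₗ[k] R ⊗[k] R :=
  (LinearMap.lTensorHom R) ∘ₗ (LinearMap.mul k R).flip

lemma lmulTb_mem_A2sub (k R : Type) [Field k] [Ring R] [Algebra k R]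
    (c : R) (q : R ⊗[k] R) (hq : q ∈ A2sub k R) : lmulTb k R c q ∈ A2sub k R := by
  have h : (LinearMap.mul' k R) ∘ₗ (lmulTb k R c)
      = (LinearMap.mulLeft k c) ∘ₗ (LinearMap.mul' k R) := by
    apply TensorProduct.ext'
    intro x y
    simp [lmulTb, mul_assoc]
  simp only [A2sub, LinearMap.mem_ker] at hq ⊢
  have := LinearMap.congr_fun h q
  simp only [LinearMap.comp_apply] at this
  rw [this, hq]
  simp

lemma rmulTb_mem_A2sub (k R : Type) [Field k] [Ring R] [Algebra k R]
    (c : R) (q : R ⊗[k] R) (hq : q ∈ A2sub k R) : rmulTb k R c q ∈ A2sub k R := by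
  have h : (LinearMap.mul' k R) ∘ₗ (rmulTb k R c)
      = (LinearMap.mulRight k c) ∘ₗ (LinearMap.mul' k R) := by
    apply TensorProduct.ext'
    intro x y
    simp [rmulTb, mul_assoc]
  simp only [A2sub, LinearMap.mem_ker] at hq ⊢
  have := LinearMap.congr_fun h q
  simp only [LinearMap.comp_apply] at this
  rw [this, hq]
  simp

/-- The map `D : R → R ⊗ R`, `D b = 1 ⊗ b - b ⊗ 1`. -/
noncomputable def Dmap (k R : Type) [Field k] [Ring R] [Algebra k R] :
    R →ₗ[k] R ⊗[k] R :=
  (TensorProduct.mk k R R) 1 - (TensorProduct.mk k R R).flip 1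

lemma Dmap_mem_A2sub (k R : Type) [Field k] [Ring R] [Algebra k R] (b : R) :
    Dmap k R b ∈ A2sub k R := by
  simp [Dmap, A2sub, LinearMap.mem_ker]

/-- Descend a bilinear action `act` of `R` on `M` to the quotient `p ⧸ (N ∩ p)` of an
action-stable submodule `p ⊆ M` by an action-stable submodule `N`. -/
noncomputable def descend {k M R : Type} [Field k] [AddCommGroup M] [Module k M]
    [AddCommGroup R] [Module k R]
    (p N : Submodule k M) (act : R →ₗ[k] M →ₗ[k] M)
    (hp : ∀ (c : R), ∀ x ∈ p, act c x ∈ p)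
    (hN : ∀ (c : R), ∀ x ∈ N, act c x ∈ N) :
    R →ₗ[k] (p ⧸ N.comap p.subtype) →ₗ[k] (p ⧸ N.comap p.subtype) where
  toFun c := Submodule.mapQ _ _ ((act c).restrict (hp c))
    (fun x hx => by
      simp only [Submodule.mem_comap, LinearMap.restrict_apply] at hx ⊢
      exact hN c _ hx)
  map_add' c c' := by
    apply Submodule.linearMap_qext
    ext x
    simp only [LinearMap.comp_apply, Submodule.mkQ_apply, Submodule.mapQ_apply,
      LinearMap.add_apply]
    rw [← Submodule.Quotient.mk_add]
    congr 1
    ext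
    simp [LinearMap.restrict_apply, map_add]
  map_smul' t c := by
    apply Submodule.linearMap_qext
    ext x
    simp only [LinearMap.comp_apply, Submodule.mkQ_apply, Submodule.mapQ_apply,
      RingHom.id_apply, LinearMap.smul_apply]
    rw [← Submodule.Quotient.mk_smul]
    congr 1
    ext
    simp [LinearMap.restrict_apply, map_smul]

/-- The differential `d = π ∘ D : R → A²/N` of the quotient first order
differential calculus. -/
noncomputable def dQ (k R : Type) [Field k] [Ring R] [Algebra k R]
    (N : Submodule k (R ⊗[k] R)) :
    R →ₗ[k] ((A2sub k R) ⧸ N.comap (A2sub k R).subtype) :=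
  (N.comap (A2sub k R).subtype).mkQ ∘ₗ
    (LinearMap.codRestrict (A2sub k R) (Dmap k R) (Dmap_mem_A2sub k R))

/-- `Φˡ_{α,β} : q ↦ Σ a_k c_k ⊗ b_k ⊗ d_k` where `(Δ ⊗ Δ)(q) = Σ a_k ⊗ b_k ⊗ c_k ⊗ d_k`. -/
noncomputable def PhiL {k : Type} [Field k] {G : Type} [Group G]
    (A : G → Type) [∀ α, Ring (A α)] [∀ α, Algebra k (A α)]
    (Δ : ∀ α β γ : G, α * β = γ → (A γ →ₐ[k] A α ⊗[k] A β))
    (α β γ : G) (h : α * β = γ) :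
    (A γ ⊗[k] A γ) →ₗ[k] A α ⊗[k] (A β ⊗[k] A β) :=
  (TensorProduct.map (LinearMap.mul' k (A α)) LinearMap.id) ∘ₗ
    (TensorProduct.tensorTensorTensorComm k (A α) (A β) (A α) (A β)).toLinearMap ∘ₗ
    (TensorProduct.map (Δ α β γ h).toLinearMap (Δ α β γ h).toLinearMap)

/-- `Φʳ_{α,β} : q ↦ Σ a_k ⊗ c_k ⊗ b_k d_k` where `(Δ ⊗ Δ)(q) = Σ a_k ⊗ b_k ⊗ c_k ⊗ d_k`. -/
noncomputable def PhiR {k : Type} [Field k] {G : Type} [Group G]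
    (A : G → Type) [∀ α, Ring (A α)] [∀ α, Algebra k (A α)]
    (Δ : ∀ α β γ : G, α * β = γ → (A γ →ₐ[k] A α ⊗[k] A β))
    (α β γ : G) (h : α * β = γ) :
    (A γ ⊗[k] A γ) →ₗ[k] (A α ⊗[k] A α) ⊗[k] A β :=
  (TensorProduct.map LinearMap.id (LinearMap.mul' k (A β))) ∘ₗ
    (TensorProduct.tensorTensorTensorComm k (A α) (A β) (A α) (A β)).toLinearMap ∘ₗ
    (TensorProduct.map (Δ α β γ h).toLinearMap (Δ α β γ h).toLinearMap)

section TensorMultiplication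

variable {k : Type} [Field k] {P Q T R U : Type} [Ring P] [Algebra k P] [Ring Q] [Algebra k Q]
  [Ring T] [Algebra k T] [Ring R] [Algebra k R] [Ring U] [Algebra k U]

/-- The linear map `(a ⊗ b) ⊗ (c ⊗ d) ↦ a c ⊗ (b ⊗ d)`. -/
noncomputable def mulFst (k P M : Type) [Field k] [Ring P] [Algebra k P]
    [AddCommGroup M] [Module k M] :
    (P ⊗[k] M) ⊗[k] (P ⊗[k] M) →ₗ[k] P ⊗[k] (M ⊗[k] M) :=
  (TensorProduct.map (LinearMap.mul' k P) LinearMap.id) ∘ₗ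
    (TensorProduct.tensorTensorTensorComm k P M P M).toLinearMap

/-- The linear map `(a ⊗ b) ⊗ (c ⊗ d) ↦ (a ⊗ c) ⊗ b d`. -/
noncomputable def mulSnd (k M Q : Type) [Field k] [Ring Q] [Algebra k Q]
    [AddCommGroup M] [Module k M] :
    (M ⊗[k] Q) ⊗[k] (M ⊗[k] Q) →ₗ[k] (M ⊗[k] M) ⊗[k] Q :=
  (TensorProduct.map LinearMap.id (LinearMap.mul' k Q)) ∘ₗ
    (TensorProduct.tensorTensorTensorComm k M Q M Q).toLinearMap

@[simp] lemma mulFst_tmul {M : Type} [AddCommGroup M] [Module k M] (a c : P) (b d : M) :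
    mulFst k P M ((a ⊗ₜ b) ⊗ₜ (c ⊗ₜ d)) = (a * c) ⊗ₜ (b ⊗ₜ d) := by
  simp [mulFst]

@[simp] lemma mulSnd_tmul {M : Type} [AddCommGroup M] [Module k M] (a c : M) (b d : Q) :
    mulSnd k M Q ((a ⊗ₜ b) ⊗ₜ (c ⊗ₜ d)) = (a ⊗ₜ c) ⊗ₜ (b * d) := by
  simp [mulSnd]

@[simp] lemma tact_tmul {V W M N : Type}
    [AddCommGroup V] [Module k V] [AddCommGroup W] [Module k W]
    [AddCommGroup M] [Module k M] [AddCommGroup N] [Module k N]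
    (f : V →ₗ[k] M →ₗ[k] M) (g : W →ₗ[k] N →ₗ[k] N) (v : V) (w : W) (m : M) (n : N) :
    tact f g (v ⊗ₜ w) (m ⊗ₜ n) = f v m ⊗ₜ g w n := by
  simp [tact]

@[simp] lemma lmulTb_tmul (c a b : R) : lmulTb k R c (a ⊗ₜ b) = (c * a) ⊗ₜ b := by
  simp [lmulTb]

@[simp] lemma rmulTb_tmul (c a b : R) : rmulTb k R c (a ⊗ₜ b) = a ⊗ₜ (b * c) := by
  simp [rmulTb]

/-- Linear maps out of `(M ⊗ N) ⊗ (M' ⊗ N')` are equal if they agree on pure tensors. -/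
lemma eq_of_eq_on_tmul {M N M' N' V : Type}
    [AddCommGroup M] [Module k M] [AddCommGroup N] [Module k N]
    [AddCommGroup M'] [Module k M'] [AddCommGroup N'] [Module k N']
    [AddCommGroup V] [Module k V]
    {f g : (M ⊗[k] N) ⊗[k] (M' ⊗[k] N') →ₗ[k] V}
    (h : ∀ a b c d, f ((a ⊗ₜ b) ⊗ₜ (c ⊗ₜ d)) = g ((a ⊗ₜ b) ⊗ₜ (c ⊗ₜ d))) : f = g := by
  ext a b c d
  exact h a b c d

lemma mulFst_mul_left (D X Y : P ⊗[k] Q) :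
    mulFst k P Q ((D * X) ⊗ₜ Y)
      = tact (LinearMap.mul k P) (lmulTb k Q) D (mulFst k P Q (X ⊗ₜ Y)) := by
  induction D with
  | zero => simp
  | add _ _ h₁ h₂ => simp only [add_mul, add_tmul, map_add, h₁, h₂, LinearMap.add_apply]
  | tmul d e =>
    induction X with
    | zero => simp
    | add _ _ h₁ h₂ => simp only [mul_add, add_tmul, map_add, h₁, h₂]
    | tmul a b =>
      induction Y with
      | zero => simp
      | add _ _ h₁ h₂ => simp only [tmul_add, map_add, h₁, h₂]
      | tmul => simp [mul_assoc]

lemma mulFst_mul_right (D X Y : P ⊗[k] Q) :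
    mulFst k P Q (X ⊗ₜ (Y * D))
      = tact (LinearMap.mul k P).flip (rmulTb k Q) D (mulFst k P Q (X ⊗ₜ Y)) := by
  induction D with
  | zero => simp
  | add _ _ h₁ h₂ => simp only [mul_add, tmul_add, map_add, h₁, h₂, LinearMap.add_apply]
  | tmul d e =>
    induction X with
    | zero => simp
    | add _ _ h₁ h₂ => simp only [add_tmul, map_add, h₁, h₂]
    | tmul a b =>
      induction Y with
      | zero => simp
      | add _ _ h₁ h₂ => simp only [add_mul, tmul_add, map_add, h₁, h₂]
      | tmul => simp [mul_assoc]

lemma mulSnd_mul_left (D X Y : P ⊗[k] Q) :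
    mulSnd k P Q ((D * X) ⊗ₜ Y)
      = tact (lmulTb k P) (LinearMap.mul k Q) D (mulSnd k P Q (X ⊗ₜ Y)) := by
  induction D with
  | zero => simp
  | add _ _ h₁ h₂ => simp only [add_mul, add_tmul, map_add, h₁, h₂, LinearMap.add_apply]
  | tmul d e =>
    induction X with
    | zero => simp
    | add _ _ h₁ h₂ => simp only [mul_add, add_tmul, map_add, h₁, h₂]
    | tmul a b =>
      induction Y with
      | zero => simp
      | add _ _ h₁ h₂ => simp only [tmul_add, map_add, h₁, h₂]
      | tmul => simp [mul_assoc]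

lemma mulSnd_mul_right (D X Y : P ⊗[k] Q) :
    mulSnd k P Q (X ⊗ₜ (Y * D))
      = tact (rmulTb k P) (LinearMap.mul k Q).flip D (mulSnd k P Q (X ⊗ₜ Y)) := by
  induction D with
  | zero => simp
  | add _ _ h₁ h₂ => simp only [mul_add, tmul_add, map_add, h₁, h₂, LinearMap.add_apply]
  | tmul d e =>
    induction X with
    | zero => simp
    | add _ _ h₁ h₂ => simp only [add_tmul, map_add, h₁, h₂]
    | tmul a b =>
      induction Y with
      | zero => simp
      | add _ _ h₁ h₂ => simp only [add_mul, tmul_add, map_add, h₁, h₂]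
      | tmul => simp [mul_assoc]

lemma lTensor_mul'_mulFst (X Y : P ⊗[k] Q) :
    (LinearMap.mul' k Q).lTensor P (mulFst k P Q (X ⊗ₜ Y)) = X * Y := by
  have h : (LinearMap.mul' k Q).lTensor P ∘ₗ mulFst k P Q = LinearMap.mul' k (P ⊗[k] Q) :=
    eq_of_eq_on_tmul fun a b c d => by simp
  simpa using LinearMap.congr_fun h (X ⊗ₜ Y)

lemma rTensor_mul'_mulSnd (X Y : P ⊗[k] Q) :
    (LinearMap.mul' k P).rTensor Q (mulSnd k P Q (X ⊗ₜ Y)) = X * Y := by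
  have h : (LinearMap.mul' k P).rTensor Q ∘ₗ mulSnd k P Q = LinearMap.mul' k (P ⊗[k] Q) :=
    eq_of_eq_on_tmul fun a b c d => by simp
  simpa using LinearMap.congr_fun h (X ⊗ₜ Y)

lemma lid_rTensor_mulFst (e : P →ₐ[k] k) (X Y : P ⊗[k] Q) :
    TensorProduct.lid k (Q ⊗[k] Q)
        (e.toLinearMap.rTensor (Q ⊗[k] Q) (mulFst k P Q (X ⊗ₜ Y)))
      = TensorProduct.lid k Q (e.toLinearMap.rTensor Q X) ⊗ₜ
        TensorProduct.lid k Q (e.toLinearMap.rTensor Q Y) := by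
  have h : (TensorProduct.lid k (Q ⊗[k] Q)).toLinearMap ∘ₗ
        e.toLinearMap.rTensor (Q ⊗[k] Q) ∘ₗ mulFst k P Q
      = TensorProduct.map ((TensorProduct.lid k Q).toLinearMap ∘ₗ e.toLinearMap.rTensor Q)
        ((TensorProduct.lid k Q).toLinearMap ∘ₗ e.toLinearMap.rTensor Q) :=
    eq_of_eq_on_tmul fun a b c d => by
      simp only [LinearMap.comp_apply, LinearEquiv.coe_coe, mulFst_tmul, map_tmul,
        LinearMap.rTensor_tmul, AlgHom.toLinearMap_apply, lid_tmul, map_mul, smul_tmul_smul]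
  simpa using LinearMap.congr_fun h (X ⊗ₜ Y)

lemma rid_lTensor_mulSnd (e : Q →ₐ[k] k) (X Y : P ⊗[k] Q) :
    TensorProduct.rid k (P ⊗[k] P)
        (e.toLinearMap.lTensor (P ⊗[k] P) (mulSnd k P Q (X ⊗ₜ Y)))
      = TensorProduct.rid k P (e.toLinearMap.lTensor P X) ⊗ₜ
        TensorProduct.rid k P (e.toLinearMap.lTensor P Y) := by
  have h : (TensorProduct.rid k (P ⊗[k] P)).toLinearMap ∘ₗ
        e.toLinearMap.lTensor (P ⊗[k] P) ∘ₗ mulSnd k P Q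
      = TensorProduct.map ((TensorProduct.rid k P).toLinearMap ∘ₗ e.toLinearMap.lTensor P)
        ((TensorProduct.rid k P).toLinearMap ∘ₗ e.toLinearMap.lTensor P) :=
    eq_of_eq_on_tmul fun a b c d => by
      simp only [LinearMap.comp_apply, LinearEquiv.coe_coe, mulSnd_tmul, map_tmul,
        LinearMap.lTensor_tmul, AlgHom.toLinearMap_apply, rid_tmul, map_mul, smul_tmul_smul]
  simpa using LinearMap.congr_fun h (X ⊗ₜ Y)

lemma assoc_rTensor_mulFst (D : R →ₐ[k] P ⊗[k] Q) (X Y : R ⊗[k] T) :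
    TensorProduct.assoc k P Q (T ⊗[k] T)
        (D.toLinearMap.rTensor (T ⊗[k] T) (mulFst k R T (X ⊗ₜ Y)))
      = (mulFst k Q T).lTensor P (mulFst k P (Q ⊗[k] T)
          (TensorProduct.assoc k P Q T (D.toLinearMap.rTensor T X) ⊗ₜ
            TensorProduct.assoc k P Q T (D.toLinearMap.rTensor T Y))) := by
  have h : (TensorProduct.assoc k P Q (T ⊗[k] T)).toLinearMap ∘ₗ
        D.toLinearMap.rTensor (T ⊗[k] T) ∘ₗ mulFst k R T
      = (mulFst k Q T).lTensor P ∘ₗ mulFst k P (Q ⊗[k] T) ∘ₗ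
        TensorProduct.map
          ((TensorProduct.assoc k P Q T).toLinearMap ∘ₗ D.toLinearMap.rTensor T)
          ((TensorProduct.assoc k P Q T).toLinearMap ∘ₗ D.toLinearMap.rTensor T) := by
    refine eq_of_eq_on_tmul fun a b c d => ?_
    simp only [LinearMap.comp_apply, mulFst_tmul, LinearMap.rTensor_tmul, map_tmul,
      AlgHom.toLinearMap_apply, map_mul, LinearEquiv.coe_coe]
    induction D a with
    | zero => simp
    | add _ _ h₁ h₂ => simp only [add_mul, add_tmul, map_add, h₁, h₂]
    | tmul p q =>
      induction D c with
      | zero => simp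
      | add _ _ h₁ h₂ => simp only [mul_add, add_tmul, tmul_add, map_add, h₁, h₂]
      | tmul => simp
  simpa using LinearMap.congr_fun h (X ⊗ₜ Y)

lemma lTensor_comp_mulFst (E : U →ₐ[k] Q ⊗[k] T) {V : Type} [AddCommGroup V] [Module k V]
    (F : (Q ⊗[k] T) ⊗[k] (Q ⊗[k] T) →ₗ[k] V) (X Y : P ⊗[k] U) :
    (F ∘ₗ TensorProduct.map E.toLinearMap E.toLinearMap).lTensor P (mulFst k P U (X ⊗ₜ Y))
      = F.lTensor P (mulFst k P (Q ⊗[k] T)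
          (E.toLinearMap.lTensor P X ⊗ₜ E.toLinearMap.lTensor P Y)) := by
  have h : (F ∘ₗ TensorProduct.map E.toLinearMap E.toLinearMap).lTensor P ∘ₗ mulFst k P U
      = F.lTensor P ∘ₗ mulFst k P (Q ⊗[k] T) ∘ₗ
        TensorProduct.map (E.toLinearMap.lTensor P) (E.toLinearMap.lTensor P) :=
    eq_of_eq_on_tmul fun a b c d => by simp
  simpa using LinearMap.congr_fun h (X ⊗ₜ Y)

lemma rTensor_comp_mulSnd (D : R →ₐ[k] P ⊗[k] Q) {V : Type} [AddCommGroup V] [Module k V]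
    (F : (P ⊗[k] Q) ⊗[k] (P ⊗[k] Q) →ₗ[k] V) (X Y : R ⊗[k] T) :
    (F ∘ₗ TensorProduct.map D.toLinearMap D.toLinearMap).rTensor T (mulSnd k R T (X ⊗ₜ Y))
      = F.rTensor T (mulSnd k (P ⊗[k] Q) T
          (D.toLinearMap.rTensor T X ⊗ₜ D.toLinearMap.rTensor T Y)) := by
  have h : (F ∘ₗ TensorProduct.map D.toLinearMap D.toLinearMap).rTensor T ∘ₗ mulSnd k R T
      = F.rTensor T ∘ₗ mulSnd k (P ⊗[k] Q) T ∘ₗ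
        TensorProduct.map (D.toLinearMap.rTensor T) (D.toLinearMap.rTensor T) :=
    eq_of_eq_on_tmul fun a b c d => by simp
  simpa using LinearMap.congr_fun h (X ⊗ₜ Y)

lemma lTensor_mulSnd (E : U →ₐ[k] Q ⊗[k] T) (X Y : P ⊗[k] U) :
    E.toLinearMap.lTensor (P ⊗[k] P) (mulSnd k P U (X ⊗ₜ Y))
      = TensorProduct.assoc k (P ⊗[k] P) Q T ((mulSnd k P Q).rTensor T
          (mulSnd k (P ⊗[k] Q) T
            ((TensorProduct.assoc k P Q T).symm (E.toLinearMap.lTensor P X) ⊗ₜ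
              (TensorProduct.assoc k P Q T).symm (E.toLinearMap.lTensor P Y)))) := by
  have h : E.toLinearMap.lTensor (P ⊗[k] P) ∘ₗ mulSnd k P U
      = (TensorProduct.assoc k (P ⊗[k] P) Q T).toLinearMap ∘ₗ (mulSnd k P Q).rTensor T ∘ₗ
        mulSnd k (P ⊗[k] Q) T ∘ₗ TensorProduct.map
          ((TensorProduct.assoc k P Q T).symm.toLinearMap ∘ₗ E.toLinearMap.lTensor P)
          ((TensorProduct.assoc k P Q T).symm.toLinearMap ∘ₗ E.toLinearMap.lTensor P) := by
    refine eq_of_eq_on_tmul fun a b c d => ?_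
    simp only [LinearMap.comp_apply, mulSnd_tmul, LinearMap.lTensor_tmul, map_tmul,
      AlgHom.toLinearMap_apply, map_mul, LinearEquiv.coe_coe]
    induction E b with
    | zero => simp
    | add _ _ h₁ h₂ => simp only [add_mul, add_tmul, tmul_add, map_add, h₁, h₂]
    | tmul p q =>
      induction E d with
      | zero => simp
      | add _ _ h₁ h₂ => simp only [mul_add, tmul_add, map_add, h₁, h₂]
      | tmul => simp
  simpa using LinearMap.congr_fun h (X ⊗ₜ Y)

lemma assoc_rTensor_mulFst_mulSnd (X Y : (P ⊗[k] Q) ⊗[k] T) :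
    TensorProduct.assoc k P (Q ⊗[k] Q) T
        ((mulFst k P Q).rTensor T (mulSnd k (P ⊗[k] Q) T (X ⊗ₜ Y)))
      = (mulSnd k Q T).lTensor P (mulFst k P (Q ⊗[k] T)
          (TensorProduct.assoc k P Q T X ⊗ₜ TensorProduct.assoc k P Q T Y)) := by
  have h : (TensorProduct.assoc k P (Q ⊗[k] Q) T).toLinearMap ∘ₗ
        (mulFst k P Q).rTensor T ∘ₗ mulSnd k (P ⊗[k] Q) T
      = (mulSnd k Q T).lTensor P ∘ₗ mulFst k P (Q ⊗[k] T) ∘ₗ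
        TensorProduct.map (TensorProduct.assoc k P Q T).toLinearMap
          (TensorProduct.assoc k P Q T).toLinearMap := by
    ext
    simp
  simpa using LinearMap.congr_fun h (X ⊗ₜ Y)

lemma range_lTensor_A2sub :
    LinearMap.range ((A2sub k Q).subtype.lTensor P)
      = LinearMap.ker ((LinearMap.mul' k Q).lTensor P) :=
  (LinearMap.exact_iff.mp (Module.Flat.lTensor_exact P
    (LinearMap.exact_subtype_ker_map (LinearMap.mul' k Q)))).symm

lemma range_rTensor_A2sub :
    LinearMap.range ((A2sub k P).subtype.rTensor Q)
      = LinearMap.ker ((LinearMap.mul' k P).rTensor Q) :=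
  (LinearMap.exact_iff.mp (Module.Flat.rTensor_exact Q
    (LinearMap.exact_subtype_ker_map (LinearMap.mul' k P)))).symm

end TensorMultiplication

section Coactions

variable {k : Type} [Field k] {G : Type} [Group G]
  {A : G → Type} [∀ α, Ring (A α)] [∀ α, Algebra k (A α)]
  (Δ : ∀ α β γ : G, α * β = γ → (A γ →ₐ[k] A α ⊗[k] A β))

lemma PhiL_eq_comp (α β γ : G) (h : α * β = γ) :
    PhiL A Δ α β γ h = mulFst k (A α) (A β) ∘ₗ
      TensorProduct.map (Δ α β γ h).toLinearMap (Δ α β γ h).toLinearMap := rfl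

lemma PhiR_eq_comp (α β γ : G) (h : α * β = γ) :
    PhiR A Δ α β γ h = mulSnd k (A α) (A β) ∘ₗ
      TensorProduct.map (Δ α β γ h).toLinearMap (Δ α β γ h).toLinearMap := rfl

@[simp] lemma PhiL_tmul (α β γ : G) (h : α * β = γ) (x y : A γ) :
    PhiL A Δ α β γ h (x ⊗ₜ y) = mulFst k (A α) (A β) (Δ α β γ h x ⊗ₜ Δ α β γ h y) := rfl

@[simp] lemma PhiR_tmul (α β γ : G) (h : α * β = γ) (x y : A γ) :
    PhiR A Δ α β γ h (x ⊗ₜ y) = mulSnd k (A α) (A β) (Δ α β γ h x ⊗ₜ Δ α β γ h y) := rfl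

lemma lTensor_mul'_PhiL (α β γ : G) (h : α * β = γ) (q : A γ ⊗[k] A γ) :
    (LinearMap.mul' k (A β)).lTensor (A α) (PhiL A Δ α β γ h q)
      = Δ α β γ h (LinearMap.mul' k (A γ) q) := by
  induction q with
  | zero => simp
  | add _ _ h₁ h₂ => simp only [map_add, h₁, h₂]
  | tmul => simp [lTensor_mul'_mulFst]

lemma rTensor_mul'_PhiR (α β γ : G) (h : α * β = γ) (q : A γ ⊗[k] A γ) :
    (LinearMap.mul' k (A α)).rTensor (A β) (PhiR A Δ α β γ h q)
      = Δ α β γ h (LinearMap.mul' k (A γ) q) := by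
  induction q with
  | zero => simp
  | add _ _ h₁ h₂ => simp only [map_add, h₁, h₂]
  | tmul => simp [rTensor_mul'_mulSnd]

end Coactions

/-- The maps `Φˡ_{α,β}` and `Φʳ_{α,β}` map `A_{αβ}²` into
`A_α ⊗ A_β²` resp. `A_α² ⊗ A_β`, and `A² = ({A_α²}, Φˡ, Φʳ)` is a `π`-graded
bicovariant bimodule over `A`. -/
theorem A2_is_bicovariant_bimodule
    {k : Type} [Field k] {G : Type} [Group G]
    (A : G → Type) [∀ α, Ring (A α)] [∀ α, Algebra k (A α)]
    (Δ : ∀ α β γ : G, α * β = γ → (A γ →ₐ[k] A α ⊗[k] A β))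
    (ε : A 1 →ₐ[k] k)
    (S : ∀ α β : G, α⁻¹ = β → (A α →ₗ[k] A β))
    (hcoassoc : ∀ (α β γ : G) (x : A (α * β * γ)),
      (TensorProduct.assoc k (A α) (A β) (A γ))
          ((Algebra.TensorProduct.map (Δ α β (α * β) rfl) (AlgHom.id k (A γ)))
            ((Δ (α * β) γ (α * β * γ) rfl) x))
        = (Algebra.TensorProduct.map (AlgHom.id k (A α)) (Δ β γ (β * γ) rfl))
            ((Δ α (β * γ) (α * β * γ) (mul_assoc α β γ).symm) x))
    (hcounit₁ : ∀ (α : G) (x : A α),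
      (TensorProduct.rid k (A α)) ((LinearMap.lTensor (A α) ε.toLinearMap)
        ((Δ α 1 α (mul_one α)) x)) = x)
    (hcounit₂ : ∀ (α : G) (x : A α),
      (TensorProduct.lid k (A α)) ((LinearMap.rTensor (A α) ε.toLinearMap)
        ((Δ 1 α α (one_mul α)) x)) = x)
    (hantipode₁ : ∀ (α : G) (x : A 1),
      (LinearMap.mul' k (A α)) ((LinearMap.rTensor (A α) (S α⁻¹ α (inv_inv α)))
        ((Δ α⁻¹ α 1 (inv_mul_cancel α)) x)) = ε x • 1)
    (hantipode₂ : ∀ (α : G) (x : A 1),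
      (LinearMap.mul' k (A α)) ((LinearMap.lTensor (A α) (S α⁻¹ α (inv_inv α)))
        ((Δ α α⁻¹ 1 (mul_inv_cancel α)) x)) = ε x • 1) :
    -- well-definedness
    (∀ (α β : G) (q : A (α * β) ⊗[k] A (α * β)), q ∈ A2sub k (A (α * β)) →
      PhiL A Δ α β (α * β) rfl q
        ∈ LinearMap.range (LinearMap.lTensor (A α) (A2sub k (A β)).subtype))
    ∧ (∀ (α β : G) (q : A (α * β) ⊗[k] A (α * β)), q ∈ A2sub k (A (α * β)) →
      PhiR A Δ α β (α * β) rfl q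
        ∈ LinearMap.range (LinearMap.rTensor (A β) (A2sub k (A α)).subtype))
    -- Φˡ is a bimodule map
    ∧ (∀ (α β : G) (a : A (α * β)) (q : A (α * β) ⊗[k] A (α * β)),
        q ∈ A2sub k (A (α * β)) →
      PhiL A Δ α β (α * β) rfl (lmulTb k (A (α * β)) a q)
        = tact (LinearMap.mul k (A α)) (lmulTb k (A β)) ((Δ α β (α * β) rfl) a)
            (PhiL A Δ α β (α * β) rfl q))
    ∧ (∀ (α β : G) (a : A (α * β)) (q : A (α * β) ⊗[k] A (α * β)),
        q ∈ A2sub k (A (α * β)) →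
      PhiL A Δ α β (α * β) rfl (rmulTb k (A (α * β)) a q)
        = tact ((LinearMap.mul k (A α)).flip) (rmulTb k (A β)) ((Δ α β (α * β) rfl) a)
            (PhiL A Δ α β (α * β) rfl q))
    -- Φʳ is a bimodule map
    ∧ (∀ (α β : G) (a : A (α * β)) (q : A (α * β) ⊗[k] A (α * β)),
        q ∈ A2sub k (A (α * β)) →
      PhiR A Δ α β (α * β) rfl (lmulTb k (A (α * β)) a q)
        = tact (lmulTb k (A α)) (LinearMap.mul k (A β)) ((Δ α β (α * β) rfl) a)
            (PhiR A Δ α β (α * β) rfl q))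
    ∧ (∀ (α β : G) (a : A (α * β)) (q : A (α * β) ⊗[k] A (α * β)),
        q ∈ A2sub k (A (α * β)) →
      PhiR A Δ α β (α * β) rfl (rmulTb k (A (α * β)) a q)
        = tact (rmulTb k (A α)) ((LinearMap.mul k (A β)).flip) ((Δ α β (α * β) rfl) a)
            (PhiR A Δ α β (α * β) rfl q))
    -- left coassociativity and counit
    ∧ (∀ (α β γ : G) (q : A (α * β * γ) ⊗[k] A (α * β * γ)),
        q ∈ A2sub k (A (α * β * γ)) →
      (TensorProduct.assoc k (A α) (A β) (A γ ⊗[k] A γ))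
          ((LinearMap.rTensor (A γ ⊗[k] A γ) (Δ α β (α * β) rfl).toLinearMap)
            (PhiL A Δ (α * β) γ (α * β * γ) rfl q))
        = (LinearMap.lTensor (A α) (PhiL A Δ β γ (β * γ) rfl))
            (PhiL A Δ α (β * γ) (α * β * γ) (mul_assoc α β γ).symm q))
    ∧ (∀ (α : G) (q : A α ⊗[k] A α), q ∈ A2sub k (A α) →
      (TensorProduct.lid k (A α ⊗[k] A α))
        ((LinearMap.rTensor (A α ⊗[k] A α) ε.toLinearMap)
          (PhiL A Δ 1 α α (one_mul α) q)) = q)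
    -- right coassociativity and counit
    ∧ (∀ (α β γ : G) (q : A (α * β * γ) ⊗[k] A (α * β * γ)),
        q ∈ A2sub k (A (α * β * γ)) →
      (LinearMap.lTensor (A α ⊗[k] A α) (Δ β γ (β * γ) rfl).toLinearMap)
          (PhiR A Δ α (β * γ) (α * β * γ) (mul_assoc α β γ).symm q)
        = (TensorProduct.assoc k (A α ⊗[k] A α) (A β) (A γ))
            ((LinearMap.rTensor (A γ) (PhiR A Δ α β (α * β) rfl))
              (PhiR A Δ (α * β) γ (α * β * γ) rfl q)))
    ∧ (∀ (α : G) (q : A α ⊗[k] A α), q ∈ A2sub k (A α) →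
      (TensorProduct.rid k (A α ⊗[k] A α))
        ((LinearMap.lTensor (A α ⊗[k] A α) ε.toLinearMap)
          (PhiR A Δ α 1 α (mul_one α) q)) = q)
    -- bicovariance compatibility
    ∧ (∀ (α β γ : G) (q : A (α * β * γ) ⊗[k] A (α * β * γ)),
        q ∈ A2sub k (A (α * β * γ)) →
      (TensorProduct.assoc k (A α) (A β ⊗[k] A β) (A γ))
          ((LinearMap.rTensor (A γ) (PhiL A Δ α β (α * β) rfl))
            (PhiR A Δ (α * β) γ (α * β * γ) rfl q))
        = (LinearMap.lTensor (A α) (PhiR A Δ β γ (β * γ) rfl))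
            (PhiL A Δ α (β * γ) (α * β * γ) (mul_assoc α β γ).symm q)) := by
  have hco : ∀ (α β γ : G) (x : A (α * β * γ)),
      TensorProduct.assoc k (A α) (A β) (A γ)
          ((Δ α β (α * β) rfl).toLinearMap.rTensor (A γ) (Δ (α * β) γ (α * β * γ) rfl x))
        = (Δ β γ (β * γ) rfl).toLinearMap.lTensor (A α)
            (Δ α (β * γ) (α * β * γ) (mul_assoc α β γ).symm x) := hcoassoc
  refine ⟨fun α β q hq => ?_, fun α β q hq => ?_, fun α β a q hq => ?_, fun α β a q hq => ?_,
    fun α β a q hq => ?_, fun α β a q hq => ?_, fun α β γ q hq => ?_, fun α q hq => ?_,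
    fun α β γ q hq => ?_, fun α q hq => ?_, fun α β γ q hq => ?_⟩
  · rw [A2sub, LinearMap.mem_ker] at hq
    rw [range_lTensor_A2sub, LinearMap.mem_ker, lTensor_mul'_PhiL, hq, map_zero]
  · rw [A2sub, LinearMap.mem_ker] at hq
    rw [range_rTensor_A2sub, LinearMap.mem_ker, rTensor_mul'_PhiR, hq, map_zero]
  all_goals
    clear hq
    induction q with
    | zero => simp only [map_zero]
    | add _ _ h₁ h₂ => simp only [map_add, h₁, h₂]
    | tmul x y => ?_
  · rw [lmulTb_tmul, PhiL_tmul, PhiL_tmul, map_mul, mulFst_mul_left]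
  · rw [rmulTb_tmul, PhiL_tmul, PhiL_tmul, map_mul, mulFst_mul_right]
  · rw [lmulTb_tmul, PhiR_tmul, PhiR_tmul, map_mul, mulSnd_mul_left]
  · rw [rmulTb_tmul, PhiR_tmul, PhiR_tmul, map_mul, mulSnd_mul_right]
  · rw [PhiL_tmul, PhiL_tmul, assoc_rTensor_mulFst, PhiL_eq_comp, lTensor_comp_mulFst, hco, hco]
  · rw [PhiL_tmul, lid_rTensor_mulFst, hcounit₂, hcounit₂]
  · rw [PhiR_tmul, PhiR_tmul, lTensor_mulSnd, PhiR_eq_comp, rTensor_comp_mulSnd, ← hco, ← hco,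
      LinearEquiv.symm_apply_apply, LinearEquiv.symm_apply_apply]
  · rw [PhiR_tmul, rid_lTensor_mulSnd, hcounit₁, hcounit₁]
  · rw [PhiR_tmul, PhiL_tmul, PhiL_eq_comp, rTensor_comp_mulSnd, assoc_rTensor_mulFst_mulSnd,
      hco, hco, PhiR_eq_comp, lTensor_comp_mulFst]
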